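/- (First Melnikov function with vanishing constant term.) Let λ₁, λ₄ be real numbers with (λ₁, λ₄) ≠ (0, 0), and set M₁(h) = λ₁·I_0(h) + λ₄·I_2(h). If M₁(h) → 0 as h → 0⁺ (equivalently, (4/3)·λ₁ + (16/15)·λ₄ = 0), then λ₁ ≠ 0 and M₁(h)/(h·ln h) → −λ₁ as h → 0⁺; in particular the coefficient of h·ln h in the expansion of M₁ is nonzero. -/

import Mathlib

open Real Set Filter intervalIntegral

/-- Right endpoint of the exterior oval: `x_max(h) = √(1 + √(1+4h))`. -/
noncomputable def xmax (h : ℝ) : ℝ := Real.sqrt (1 + Real.sqrt (1 + 4*h))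

/-- Complete elliptic integral `I_i(h) = ∫_{-x_max}^{x_max} x^i √(2h + x² - x⁴/2) dx`. -/
noncomputable def ellI (i : ℕ) (h : ℝ) : ℝ :=
  ∫ x in (-xmax h)..(xmax h), x^i * Real.sqrt (2*h + x^2 - x^4/2)

/-- Complete elliptic integral `I'_i(h) = ∫_{-x_max}^{x_max} x^i (2h + x² - x⁴/2)^{-1/2} dx`. -/
noncomputable def ellI' (i : ℕ) (h : ℝ) : ℝ :=
  ∫ x in (-xmax h)..(xmax h), x^i / Real.sqrt (2*h + x^2 - x^4/2)

noncomputable def JJ (i : ℕ) (k : ℝ) : ℝ :=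
  ∫ u in (0:ℝ)..1, u^i * (√(1 - u^2) * √(u^2 + k))

noncomputable def AA (h : ℝ) : ℝ := 1 + √(1 + 4*h)
noncomputable def kk (h : ℝ) : ℝ := 4 * h / (AA h)^2

lemma AA_pos (h : ℝ) : 0 < AA h := by unfold AA; positivity

lemma AA_eq {h : ℝ} (hh : 0 < h) : AA h ^ 2 = 2 * AA h + 4 * h := by
  have := Real.sq_sqrt (show (0:ℝ) ≤ 1 + 4 * h by linarith)
  unfold AA; nlinarith

lemma JJ_cont (i : ℕ) (k : ℝ) : Continuous (fun u : ℝ => u^i * (√(1 - u^2) * √(u^2 + k))) := by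
  fun_prop

lemma ellI_eq (i : ℕ) (hi : Even i) {h : ℝ} (hh : 0 < h) :
    ellI i h = √(AA h) * (√(AA h))^i * (AA h * √2) * JJ i (kk h) := by
  have hA := AA_pos h
  have hA2 := AA_eq hh
  have hk : 0 < kk h := by unfold kk; positivity
  have hc2 : √(AA h) ^ 2 = AA h := Real.sq_sqrt hA.le
  have hkA : kk h * AA h ^ 2 = 4 * h := by unfold kk; field_simp
  have h2 : √2 * √2 = (2:ℝ) := Real.mul_self_sqrt (by norm_num)
  have h2p : 0 < √(2:ℝ) := by positivity
  set c := √(AA h) with hc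
  have hx : xmax h = c := rfl
  have e1 : ellI i h = c * ∫ u in (-1:ℝ)..1, (c * u)^i * √(2*h + (c*u)^2 - (c*u)^4/2) := by
    rw [intervalIntegral.mul_integral_comp_mul_left (f := fun x => x^i * √(2*h + x^2 - x^4/2))]
    unfold ellI; rw [hx]; simp
  have e2 : ∀ u : ℝ, (c * u)^i * √(2*h + (c*u)^2 - (c*u)^4/2)
      = (c^i * (AA h * √2 / 2)) * (u^i * (√(1 - u^2) * √(u^2 + kk h))) := by
    intro u
    have e3 : 2*h + (c*u)^2 - (c*u)^4/2 = (AA h * √2 / 2)^2 * ((u^2 + kk h) * (1 - u^2)) := by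
      have e4 : (c*u)^4 = (c^2)^2 * u^4 := by ring
      rw [e4, mul_pow, hc2]
      have : (AA h * √2 / 2)^2 = AA h ^ 2 / 2 := by
        rw [div_pow, mul_pow, pow_two √2, h2]; ring
      rw [this]
      linear_combination (-1/2 + u^2/2) * hkA - u^2/2 * hA2
    rw [e3, Real.sqrt_mul (by positivity), Real.sqrt_sq (by positivity),
      Real.sqrt_mul (by positivity)]
    ring
  simp_rw [e2] at e1
  rw [intervalIntegral.integral_const_mul] at e1
  have hint : ∀ a b : ℝ, IntervalIntegrable
      (fun u : ℝ => u^i * (√(1 - u^2) * √(u^2 + kk h))) MeasureTheory.volume a b :=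
    fun a b => (JJ_cont i (kk h)).intervalIntegrable a b
  have e5 : ∫ u in (-1:ℝ)..0, u^i * (√(1 - u^2) * √(u^2 + kk h)) = JJ i (kk h) := by
    have := intervalIntegral.integral_comp_neg (a := 0) (b := 1)
      (fun u : ℝ => u^i * (√(1 - u^2) * √(u^2 + kk h)))
    simp only [hi.neg_pow, neg_zero, even_two.neg_pow] at this
    exact this.symm
  rw [← intervalIntegral.integral_add_adjacent_intervals (hint (-1) 0) (hint 0 1), e5] at e1
  rw [e1]; unfold JJ; ring

lemma int1 : ∫ u in (0:ℝ)..1, u * √(1 - u^2) = 1/3 := by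
  have := intervalIntegral.integral_eq_sub_of_hasDerivAt_of_le (a := 0) (b := 1)
    (f := fun u : ℝ => -(1/3) * ((1 - u^2) * √(1 - u^2))) (f' := fun u => u * √(1 - u^2))
    (by norm_num) (by fun_prop) (by
      intro u hu
      have hp : 0 < 1 - u^2 := by nlinarith [hu.1, hu.2]
      have hs : 0 < √(1 - u^2) := Real.sqrt_pos.2 hp
      have hs2 := Real.sq_sqrt hp.le
      have h1 : HasDerivAt (fun u : ℝ => 1 - u^2) (-(2*u)) u := by
        simpa using (hasDerivAt_pow 2 u).const_sub 1
      refine ((h1.mul (h1.sqrt hp.ne')).const_mul (-(1/3))).congr_deriv ?_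
      field_simp
      rw [hs2]
      ring) ((by fun_prop : Continuous fun u : ℝ => u * √(1 - u^2)).intervalIntegrable _ _)
  rw [this]; norm_num

lemma int3 : ∫ u in (0:ℝ)..1, u^3 * √(1 - u^2) = 2/15 := by
  have := intervalIntegral.integral_eq_sub_of_hasDerivAt_of_le (a := 0) (b := 1)
    (f := fun u : ℝ => (-(1/3) * (1 - u^2) + 1/5 * (1-u^2)^2) * √(1 - u^2))
    (f' := fun u => u^3 * √(1 - u^2))
    (by norm_num) (by fun_prop) (by
      intro u hu
      have hp : 0 < 1 - u^2 := by nlinarith [hu.1, hu.2]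
      have hs : 0 < √(1 - u^2) := Real.sqrt_pos.2 hp
      have hs2 := Real.sq_sqrt hp.le
      have h1 : HasDerivAt (fun u : ℝ => 1 - u^2) (-(2*u)) u := by
        simpa using (hasDerivAt_pow 2 u).const_sub 1
      refine (((h1.const_mul (-(1/3))).add ((h1.pow 2).const_mul (1/5))).mul
        (h1.sqrt hp.ne')).congr_deriv ?_
      simp
      field_simp
      rw [hs2]
      ring) ((by fun_prop : Continuous fun u : ℝ => u^3 * √(1 - u^2)).intervalIntegrable _ _)
  rw [this]; norm_num

lemma intS {k : ℝ} (hk : 0 < k) : ∫ u in (0:ℝ)..1, √(u^2 + k)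
    = (√(1 + k) + k * log (1 + √(1 + k))) / 2 - k * log k / 4 := by
  have := intervalIntegral.integral_eq_sub_of_hasDerivAt (a := 0) (b := 1)
    (f := fun u : ℝ => (u * √(u^2 + k) + k * log (u + √(u^2 + k))) / 2)
    (f' := fun u => √(u^2 + k))
    (by
      intro u hu
      rw [uIcc_of_le (by norm_num)] at hu
      have hu0 := hu.1
      have hp : 0 < u^2 + k := by positivity
      have hs : 0 < √(u^2 + k) := Real.sqrt_pos.2 hp
      have hs2 := Real.sq_sqrt hp.le
      have h1 : HasDerivAt (fun u : ℝ => u^2 + k) (2*u) u := by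
        simpa using (hasDerivAt_pow 2 u).add_const k
      have h2 := h1.sqrt hp.ne'
      have hl : 0 < u + √(u^2+k) := by positivity
      refine ((((hasDerivAt_id u).mul h2).add
        ((((hasDerivAt_id u).add h2).log hl.ne').const_mul k)).div_const 2).congr_deriv ?_
      simp only [id, Pi.add_apply]
      generalize √(u^2+k) = s at *
      have : k = s^2 - u^2 := by linarith
      subst this
      simp
      field_simp
      ring)
    ((by fun_prop : Continuous fun u : ℝ => √(u^2 + k)).intervalIntegrable _ _)
  rw [this]
  simp [Real.log_sqrt hk.le]
  ring

lemma diff_bound {k u : ℝ} (hk : 0 < k) (hu : 0 ≤ u) :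
    0 ≤ √(u^2 + k) - u ∧ u * (√(u^2 + k) - u) ≤ k / 2 := by
  have hs2 := Real.sq_sqrt (show 0 ≤ u^2 + k by positivity)
  have hs := Real.sqrt_nonneg (u^2+k)
  have h1 : u ≤ √(u^2 + k) := Real.le_sqrt_of_sq_le (by linarith)
  exact ⟨by linarith, by nlinarith [sq_nonneg (√(u^2 + k) - u)]⟩

lemma J2_bound {k : ℝ} (hk : 0 < k) : |JJ 2 k - 2/15| ≤ k := by
  have e : JJ 2 k - 2/15 = ∫ u in (0:ℝ)..1, u^2 * √(1 - u^2) * (√(u^2 + k) - u) := by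
    rw [← int3, JJ, ← intervalIntegral.integral_sub
      ((JJ_cont 2 k).intervalIntegrable _ _)
      ((by fun_prop : Continuous fun u : ℝ => u^3 * √(1 - u^2)).intervalIntegrable _ _)]
    congr 1; ext u; ring
  rw [e, ← Real.norm_eq_abs]
  refine (intervalIntegral.norm_integral_le_of_norm_le_const (C := k) ?_).trans (by simp)
  intro u hu
  rw [uIoc_of_le (by norm_num)] at hu
  obtain ⟨h1, h2⟩ := diff_bound hk hu.1.le
  have h3 : √(1 - u^2) ≤ 1 := Real.sqrt_le_one.2 (by nlinarith [hu.1])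
  have h4 := Real.sqrt_nonneg (1 - u^2)
  have h5 := hu.1
  rw [Real.norm_of_nonneg (by positivity)]
  calc u^2 * √(1 - u^2) * (√(u^2 + k) - u) = (u * √(1 - u^2)) * (u * (√(u^2 + k) - u)) := by ring
    _ ≤ (1 * 1) * (k/2) := by gcongr; exact hu.2
    _ ≤ k := by linarith

lemma J0_bound {k : ℝ} (hk : 0 < k) (hk1 : k ≤ 3) : |JJ 0 k - 1/3 + k * log k / 4| ≤ 3 * k := by
  have c1 : Continuous fun u : ℝ => √(u^2 + k) := by fun_prop
  have c2 : Continuous fun u : ℝ => u * √(1 - u^2) := by fun_prop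
  have e : JJ 0 k - 1/3 - ((∫ u in (0:ℝ)..1, √(u^2 + k)) - ∫ u in (0:ℝ)..1, u)
      = ∫ u in (0:ℝ)..1, (√(1 - u^2) - 1) * (√(u^2 + k) - u) := by
    rw [← int1, JJ, ← intervalIntegral.integral_sub
      ((JJ_cont 0 k).intervalIntegrable _ _) (c2.intervalIntegrable _ _),
      ← intervalIntegral.integral_sub (c1.intervalIntegrable _ _)
        (continuous_id'.intervalIntegrable _ _),
      ← intervalIntegral.integral_sub
        ((by fun_prop : Continuous fun u : ℝ =>
          u^0 * (√(1 - u^2) * √(u^2 + k)) - u * √(1 - u^2)).intervalIntegrable _ _)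
        ((by fun_prop : Continuous fun u : ℝ => √(u^2 + k) - u).intervalIntegrable _ _)]
    congr 1; ext u; ring
  have b : |∫ u in (0:ℝ)..1, (√(1 - u^2) - 1) * (√(u^2 + k) - u)| ≤ k := by
    rw [← Real.norm_eq_abs]
    refine (intervalIntegral.norm_integral_le_of_norm_le_const (C := k) ?_).trans (by simp)
    intro u hu
    rw [uIoc_of_le (by norm_num)] at hu
    obtain ⟨h1, h2⟩ := diff_bound hk hu.1.le
    have h3 : √(1 - u^2) ≤ 1 := Real.sqrt_le_one.2 (by nlinarith [hu.1])
    have h4 : 1 - u ≤ √(1 - u^2) := Real.le_sqrt_of_sq_le (by nlinarith [hu.1, hu.2])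
    rw [norm_mul, Real.norm_of_nonneg h1, Real.norm_of_nonpos (by linarith)]
    nlinarith
  rw [← e, intS hk, integral_id] at b
  have s1 : √(1 + k) ≤ 1 + k/2 := Real.sqrt_le_iff.2 ⟨by linarith, by nlinarith⟩
  have s2 : 1 ≤ √(1 + k) := Real.one_le_sqrt.2 (by linarith)
  have s3 : √(1 + k) ≤ 2 := Real.sqrt_le_iff.2 ⟨by linarith, by nlinarith⟩
  have l1 := Real.log_le_sub_one_of_pos (show 0 < 1 + √(1 + k) by linarith)
  have l0 := Real.log_nonneg (show 1 ≤ 1 + √(1 + k) by linarith)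
  have m1 : k * log (1 + √(1+k)) ≤ k * 2 := by gcongr; linarith
  have m0 : 0 ≤ k * log (1 + √(1+k)) := by positivity
  rw [abs_le] at b ⊢
  constructor <;> linarith [b.1, b.2]

lemma AA_tendsto : Tendsto AA (nhdsWithin 0 (Ioi 0)) (nhds 2) := by
  have : ContinuousAt AA 0 := by unfold AA; fun_prop
  have h := this.tendsto.mono_left (nhdsWithin_le_nhds (s := Ioi 0))
  convert h using 2
  unfold AA; norm_num

lemma kk_pos {h : ℝ} (hh : 0 < h) : 0 < kk h := by
  have := AA_pos h
  unfold kk; positivity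

lemma kk_tendsto : Tendsto kk (nhdsWithin 0 (Ioi 0)) (nhdsWithin 0 (Ioi 0)) := by
  refine tendsto_nhdsWithin_of_tendsto_nhds_of_eventually_within _ ?_ ?_
  · have h1 : Tendsto (fun h : ℝ => h) (nhdsWithin 0 (Ioi 0)) (nhds 0) := nhdsWithin_le_nhds
    have := (h1.const_mul 4).div (AA_tendsto.pow 2) (by norm_num)
    rw [mul_zero, zero_div] at this
    exact this
  · filter_upwards [self_mem_nhdsWithin] with h hh using kk_pos hh

lemma J2_tendsto : Tendsto (fun h => JJ 2 (kk h)) (nhdsWithin 0 (Ioi 0)) (nhds (2/15)) := by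
  rw [tendsto_iff_norm_sub_tendsto_zero]
  refine squeeze_zero' (Eventually.of_forall fun _ => norm_nonneg _) ?_
    (kk_tendsto.mono_right nhdsWithin_le_nhds)
  filter_upwards [self_mem_nhdsWithin] with h hh using J2_bound (kk_pos hh)

lemma kk_small : ∀ᶠ h in nhdsWithin 0 (Ioi 0), kk h ≤ 3 :=
  (kk_tendsto.mono_right nhdsWithin_le_nhds).eventually (eventually_le_nhds (by norm_num))

lemma J0_tendsto : Tendsto (fun h => JJ 0 (kk h)) (nhdsWithin 0 (Ioi 0)) (nhds (1/3)) := by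
  have hk0 := kk_tendsto.mono_right (nhdsWithin_le_nhds (s := Ioi (0:ℝ)))
  have h1 : Tendsto (fun h => JJ 0 (kk h) - 1/3 + kk h * log (kk h) / 4)
      (nhdsWithin 0 (Ioi 0)) (nhds 0) := by
    rw [tendsto_zero_iff_norm_tendsto_zero]
    refine squeeze_zero' (Eventually.of_forall fun _ => norm_nonneg _) ?_
      (by simpa using hk0.const_mul 3)
    filter_upwards [self_mem_nhdsWithin, kk_small] with h hh h3 using J0_bound (kk_pos hh) h3
  have h2 : Tendsto (fun h => kk h * log (kk h)) (nhdsWithin 0 (Ioi 0)) (nhds 0) := by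
    have := (Real.continuous_mul_log.tendsto 0).comp hk0
    simpa [Function.comp_def] using this
  have := (h1.sub (h2.div_const 4)).add_const (1/3)
  convert this using 2 <;> ring

lemma kAA {h : ℝ} (hh : 0 < h) : AA h = 2 + kk h * AA h := by
  have hA := AA_pos h
  have := AA_eq hh
  unfold kk; field_simp; linarith

lemma M_eq (l1 l4 : ℝ) {h : ℝ} (hh : 0 < h) : l1 * ellI 0 h + l4 * ellI 2 h
    = √(AA h) * AA h * √2 * (l1 * JJ 0 (kk h) + l4 * (AA h * JJ 2 (kk h))) := by
  rw [ellI_eq 0 (by simp) hh, ellI_eq 2 even_two hh, Real.sq_sqrt (AA_pos h).le]; ring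

lemma pre_tendsto : Tendsto (fun h => √(AA h) * AA h * √2) (nhdsWithin 0 (Ioi 0)) (nhds 4) := by
  have := ((AA_tendsto.sqrt).mul AA_tendsto).mul_const √2
  convert this using 2
  have h2 : √2 * √2 = (2:ℝ) := Real.mul_self_sqrt (by norm_num)
  linear_combination (-2) * h2

/-- If the first Melnikov function `M₁ = λ₁ I₀ + λ₄ I₂` is nontrivial and tends to `0`
as `h → 0⁺`, then `λ₁ ≠ 0` and `M₁(h)/(h ln h) → -λ₁`. -/
theorem first_melnikov_log_coefficient (l1 l4 : ℝ) (hne : (l1, l4) ≠ (0, 0))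
    (hlim : Tendsto (fun h => l1 * ellI 0 h + l4 * ellI 2 h)
      (nhdsWithin 0 (Ioi 0)) (nhds 0)) :
    l1 ≠ 0 ∧
      Tendsto (fun h => (l1 * ellI 0 h + l4 * ellI 2 h) / (h * Real.log h))
        (nhdsWithin 0 (Ioi 0)) (nhds (-l1)) := by
  have hl : l4 = -(5/4) * l1 := by
    have h1 := pre_tendsto.mul ((J0_tendsto.const_mul l1).add
      ((AA_tendsto.mul J2_tendsto).const_mul l4))
    have h2 := hlim.congr' (f₂ := fun h => √(AA h) * AA h * √2 *
      (l1 * JJ 0 (kk h) + l4 * (AA h * JJ 2 (kk h)))) (by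
        filter_upwards [self_mem_nhdsWithin] with h hh using M_eq l1 l4 hh)
    have := tendsto_nhds_unique h1 h2
    linarith
  refine ⟨fun h0 => hne (by simp [hl, h0]), ?_⟩
  have hk0 := kk_tendsto.mono_right (nhdsWithin_le_nhds (s := Ioi (0:ℝ)))
  have hlk : Tendsto (fun h => (log (kk h))⁻¹) (nhdsWithin 0 (Ioi 0)) (nhds 0) :=
    (Real.tendsto_log_nhdsGT_zero.comp kk_tendsto).inv_tendsto_atBot
  have hlh : Tendsto (fun h => (log h)⁻¹) (nhdsWithin (0:ℝ) (Ioi 0)) (nhds 0) :=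
    Real.tendsto_log_nhdsGT_zero.inv_tendsto_atBot
  -- remainder terms
  have r0 : Tendsto (fun h => (JJ 0 (kk h) - 1/3 + kk h * log (kk h) / 4) / kk h * (log (kk h))⁻¹)
      (nhdsWithin 0 (Ioi 0)) (nhds 0) := by
    refine bdd_le_mul_tendsto_zero' 3 ?_ hlk
    filter_upwards [self_mem_nhdsWithin, kk_small] with h hh h3
    rw [abs_div, abs_of_pos (kk_pos hh), div_le_iff₀ (kk_pos hh)]
    exact J0_bound (kk_pos hh) h3
  have r2 : Tendsto (fun h => (JJ 2 (kk h) - 2/15) / kk h * (log (kk h))⁻¹)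
      (nhdsWithin 0 (Ioi 0)) (nhds 0) := by
    refine bdd_le_mul_tendsto_zero' 1 ?_ hlk
    filter_upwards [self_mem_nhdsWithin] with h hh
    rw [abs_div, abs_of_pos (kk_pos hh), div_le_iff₀ (kk_pos hh), one_mul]
    exact J2_bound (kk_pos hh)
  have rat : Tendsto (fun h => 1 + log (4 / AA h ^ 2) * (log h)⁻¹)
      (nhdsWithin 0 (Ioi 0)) (nhds (1 + log (4 / 2^2) * 0)) := by
    refine Tendsto.const_add _ (Tendsto.mul ?_ hlh)
    exact (Tendsto.div tendsto_const_nhds (AA_tendsto.pow 2) (by norm_num)).log (by norm_num)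
  have key := ((pre_tendsto.mul (Tendsto.div (tendsto_const_nhds (x := 4 * l1))
    (AA_tendsto.pow 2) (by norm_num))).mul rat).mul
    (((r0.add_const (-(1/4))).sub ((AA_tendsto.mul r2).const_mul (5/4))).sub
      ((AA_tendsto.mul hlk).div_const 6))
  have hv : (4 * (4 * l1 / 2^2) * (1 + log (4/2^2) * 0) *
    (0 + -(1/4) - 5/4 * (2 * 0) - 2 * 0 / 6)) = -l1 := by ring
  rw [hv] at key
  refine key.congr' ?_
  have hklt : ∀ᶠ h in nhdsWithin 0 (Ioi 0), kk h < 1 :=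
    hk0.eventually (eventually_lt_nhds (by norm_num))
  have hhlt : ∀ᶠ h in nhdsWithin (0:ℝ) (Ioi 0), h < 1 :=
    nhdsWithin_le_nhds (eventually_lt_nhds (by norm_num))
  filter_upwards [self_mem_nhdsWithin, hklt, hhlt] with h hh hk1 hh1
  have hh : 0 < h := hh
  have hk := kk_pos hh
  have hA := AA_pos h
  rw [M_eq l1 l4 hh, hl]
  have n1 : log (kk h) ≠ 0 := (Real.log_neg hk hk1).ne
  have n2 : log h ≠ 0 := (Real.log_neg hh hh1).ne
  have e1 : log (4 / AA h ^ 2) = log (kk h) - log h := by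
    have : kk h = 4 / AA h ^ 2 * h := by unfold kk; ring
    rw [this, Real.log_mul (by positivity) hh.ne']; ring
  have e2 : h = kk h * AA h ^ 2 / 4 := by unfold kk; field_simp
  have e3 := kAA hh
  simp only [Pi.div_apply]
  rw [e1]
  generalize log h = lh at *
  generalize log (kk h) = lk at *
  generalize JJ 0 (kk h) = j0 at *
  generalize JJ 2 (kk h) = j2 at *
  generalize √(AA h) = c at *
  generalize kk h = k at *
  generalize AA h = A at *
  subst e2
  field_simp
  linear_combination (180 * c * lk * l1) * e3
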